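/- Let (ν_n) be a sequence of symmetric probability measures on ℝ, let (k_n) be a sequence of positive integers tending to infinity, and for each n let ρ_n be the pushforward of ν_n by t ↦ t². Suppose ν_n^{*k_n} converges weakly to a probability measure μ, necessarily symmetric and *-infinitely divisible, and let G be its Lévy measure, i.e. the unique symmetric positive finite measure with ∫_ℝ e^{iξt} dμ(t) = exp(∫_ℝ (cos(tξ) − 1)·(1+t²)/t² dG(t)) for all ξ ∈ ℝ (the integrand being read as −ξ²/2 at t = 0). Then ρ_n^{*k_n} converges weakly to the probability measure whose characteristic function is ξ ↦ exp[iγξ + ∫_ℝ (e^{iξx} − 1 − iξx/(x²+1))·(x²+1)/x² dσ(x)] (the integrand being read as −ξ²/2 at x = 0), where γ = ∫_ℝ (1+t²)/(1+t⁴) dG(t) and σ is the measure with density x ↦ (x²+x)/(x²+1) with respect to F, F being the pushforward of G by t ↦ t². -/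

import Mathlib

open MeasureTheory Filter Complex

/-- Classical convolution of two measures on `ℝ`. -/
noncomputable def mconv (μ ν : Measure ℝ) : Measure ℝ :=
  (μ.prod ν).map (fun p => p.1 + p.2)

/-- `n`-fold classical convolution power (`convPow μ 0 = δ_0`). -/
noncomputable def convPow (μ : Measure ℝ) : ℕ → Measure ℝ
  | 0 => Measure.dirac 0
  | n + 1 => mconv (convPow μ n) μ

/-- Weak convergence of a sequence of measures on `ℝ`. -/
def WeakTendsto (μs : ℕ → Measure ℝ) (μ : Measure ℝ) : Prop :=
  ∀ f : BoundedContinuousFunction ℝ ℝ,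
    Tendsto (fun n => ∫ x, f x ∂(μs n)) atTop (nhds (∫ x, f x ∂μ))

/-- Characteristic function of a measure on `ℝ`. -/
noncomputable def charfun (μ : Measure ℝ) (ξ : ℝ) : ℂ :=
  ∫ t, Complex.exp (Complex.I * ξ * t) ∂μ

/-- The symmetric Lévy–Khinchine integrand `(cos(tξ) − 1)(1+t²)/t²`, read as `−ξ²/2`
at `t = 0`. -/
noncomputable def levy1 (ξ t : ℝ) : ℝ :=
  if t = 0 then -ξ^2 / 2 else (Real.cos (t * ξ) - 1) * (1 + t^2) / t^2

/-- The Lévy–Khinchine integrand `(e^{iξx} − 1 − iξx/(x²+1))·(x²+1)/x²`, read as `−ξ²/2`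
at `x = 0`. -/
noncomputable def levy2 (ξ x : ℝ) : ℂ :=
  if x = 0 then (-(ξ^2) / 2 : ℝ)
  else (Complex.exp (Complex.I * ξ * x) - 1 - Complex.I * ξ * x / ((x:ℂ)^2 + 1)) *
    ((x:ℂ)^2 + 1) / (x:ℂ)^2

open scoped Topology BoundedContinuousFunction

/-- If `k n * g n → t` and `k n → ∞`, then `(1 + g n) ^ k n → exp t`. -/
lemma tendsto_one_add_pow_of_tendsto_mul {k : ℕ → ℕ} (hk : Tendsto k atTop atTop) {g : ℕ → ℂ}
    {t : ℂ} (hg : Tendsto (fun n => (k n : ℂ) * g n) atTop (𝓝 t)) :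
    Tendsto (fun n => (1 + g n) ^ k n) atTop (𝓝 (exp t)) := by
  have hk0 : ∀ᶠ n in atTop, k n ≠ 0 := hk.eventually_ne_atTop 0
  have hinv : Tendsto (fun n => ((k n : ℂ))⁻¹) atTop (𝓝 0) :=
    tendsto_inv_atTop_nhds_zero_nat.comp hk
  have hg0 : Tendsto g atTop (𝓝 0) := by
    have h := hinv.mul hg
    rw [zero_mul] at h
    refine h.congr' ?_
    filter_upwards [hk0] with n hn
    rw [inv_mul_cancel_left₀ (Nat.cast_ne_zero.2 hn)]
  have hderiv : HasDerivAt (fun z : ℂ => log (1 + z)) 1 0 := by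
    have h := ((hasDerivAt_id (0 : ℂ)).const_add 1).clog (by simp)
    simpa using h
  have hslope : Tendsto (fun n => dslope (fun z : ℂ => log (1 + z)) 0 (g n)) atTop (𝓝 1) := by
    have h := (continuousAt_dslope_same.2 hderiv.differentiableAt).tendsto.comp hg0
    rwa [dslope_same, hderiv.deriv] at h
  have hlim := (continuous_exp.tendsto _).comp (hg.mul hslope)
  rw [mul_one] at hlim
  refine hlim.congr' ?_
  filter_upwards [hg0.eventually_ne (show (0 : ℂ) ≠ -1 by simp)] with n hn
  have h1 : 1 + g n ≠ 0 := fun h => hn (eq_neg_of_add_eq_zero_right h)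
  have h2 := sub_smul_dslope (fun z : ℂ => log (1 + z)) 0 (g n)
  simp only [sub_zero, smul_eq_mul, add_zero, log_one] at h2
  simp only [Function.comp_apply]
  rw [mul_assoc, h2, exp_nat_mul, exp_log h1]

/-- If `x n → 1` and `x n ^ k n → exp L`, then `k n * (x n - 1) → L`. -/
lemma tendsto_mul_sub_one_of_tendsto_pow {k : ℕ → ℕ} {x : ℕ → ℝ} {L : ℝ}
    (hx : Tendsto x atTop (𝓝 1)) (hp : Tendsto (fun n => x n ^ k n) atTop (𝓝 (Real.exp L))) :
    Tendsto (fun n => (k n : ℝ) * (x n - 1)) atTop (𝓝 L) := by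
  have hlog : Tendsto (fun n => (k n : ℝ) * Real.log (x n)) atTop (𝓝 L) := by
    have h := (Real.continuousAt_log (Real.exp_pos L).ne').tendsto.comp hp
    rw [Real.log_exp] at h
    exact h.congr fun n => Real.log_pow _ _
  have hupper := hx.mul hlog
  rw [one_mul] at hupper
  have hpos : ∀ᶠ n in atTop, 0 < x n := hx.eventually_const_lt one_pos
  refine tendsto_of_tendsto_of_tendsto_of_le_of_le' hlog hupper ?_ ?_
  · filter_upwards [hpos] with n hn
    exact mul_le_mul_of_nonneg_left (Real.log_le_sub_one_of_pos hn) (Nat.cast_nonneg _)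
  · filter_upwards [hpos] with n hn
    have h := Real.one_sub_inv_le_log_of_pos hn
    have h2 : x n - 1 ≤ x n * Real.log (x n) := by
      have := mul_le_mul_of_nonneg_left h hn.le
      rwa [mul_sub, mul_one, mul_inv_cancel₀ hn.ne'] at this
    calc (k n : ℝ) * (x n - 1) ≤ k n * (x n * Real.log (x n)) := by gcongr
      _ = _ := by ring

lemma mul_one_sub_le_neg_log {a c : ℝ} (ha : 0 ≤ a) (hc : 0 < c) (hc1 : c ≤ 1) {k : ℕ}
    (h : c ≤ a ^ k) : k * (1 - a) ≤ -Real.log c := by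
  rcases k.eq_zero_or_pos with rfl | hk
  · simpa using Real.log_nonpos hc.le hc1
  have ha' : 0 < a := by
    refine ha.lt_of_ne' ?_
    rintro rfl
    rw [zero_pow hk.ne'] at h
    exact absurd h hc.not_ge
  have h1 : Real.log c ≤ k * Real.log a := by
    rw [← Real.log_pow]
    exact Real.log_le_log hc h
  have h2 : (k : ℝ) * Real.log a ≤ k * (a - 1) := by
    gcongr
    exact Real.log_le_sub_one_of_pos ha'
  linarith

/-- The cosine transform of a measure. -/
noncomputable def cosTransform (ν : Measure ℝ) (ξ : ℝ) : ℝ := ∫ t, Real.cos (t * ξ) ∂ν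

lemma integrable_of_continuous_of_bound {E : Type*} [NormedAddCommGroup E]
    [SecondCountableTopologyEither ℝ E]
    (ν : Measure ℝ) [IsFiniteMeasure ν] {f : ℝ → E} (hf : Continuous f) (C : ℝ)
    (hC : ∀ x, ‖f x‖ ≤ C) : Integrable f ν :=
  Integrable.of_bound hf.aestronglyMeasurable C (ae_of_all _ hC)

lemma integrable_cos_mul (ν : Measure ℝ) [IsFiniteMeasure ν] (ξ : ℝ) :
    Integrable (fun t => Real.cos (t * ξ)) ν :=
  integrable_of_continuous_of_bound ν (by fun_prop) 1 fun x => Real.abs_cos_le_one _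

lemma charfun_eq_charFun (μ : Measure ℝ) (ξ : ℝ) : charfun μ ξ = charFun μ ξ := by
  rw [charFun_apply_real, charfun]
  congr with x
  ring_nf

lemma charFun_re (ν : Measure ℝ) [IsFiniteMeasure ν] (ξ : ℝ) :
    (charFun ν ξ).re = cosTransform ν ξ := by
  rw [charFun_apply_real, cosTransform]
  have hinteg : Integrable (fun x : ℝ => cexp (ξ * x * I)) ν :=
    integrable_of_continuous_of_bound ν (by fun_prop) 1 fun x => by
      rw [← ofReal_mul, norm_exp_ofReal_mul_I]
  have h := integral_re hinteg
  simp only [RCLike.re_to_complex] at h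
  rw [← h]
  congr with x
  rw [← ofReal_mul, exp_ofReal_mul_I_re, mul_comm]

lemma charFun_eq_cosTransform (ν : Measure ℝ) [IsFiniteMeasure ν]
    (hsym : ν.map (fun x => -x) = ν) (ξ : ℝ) : charFun ν ξ = cosTransform ν ξ := by
  have hconj : (starRingEnd ℂ) (charFun ν ξ) = charFun ν ξ := by
    rw [← charFun_neg]
    have h := charFun_map_mul (μ := ν) (-1) ξ
    simp only [neg_one_mul] at h
    rw [← h, hsym]
  rw [← Complex.conj_eq_iff_re.1 hconj, charFun_re]

instance isProbabilityMeasure_convPow (ν : Measure ℝ) [IsProbabilityMeasure ν] (k : ℕ) :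
    IsProbabilityMeasure (convPow ν k) := by
  induction k with
  | zero => rw [convPow]; infer_instance
  | succ k ih =>
    rw [convPow, mconv]
    exact Measure.isProbabilityMeasure_map (by fun_prop)

lemma charFun_convPow (ν : Measure ℝ) [IsProbabilityMeasure ν] (k : ℕ) (ξ : ℝ) :
    charFun (convPow ν k) ξ = charFun ν ξ ^ k := by
  induction k with
  | zero => simp [convPow]
  | succ k ih =>
    have h : convPow ν (k + 1) = convPow ν k ∗ ν := rfl
    rw [h, charFun_conv, ih, pow_succ]

lemma WeakTendsto.tendsto_charFun {μs : ℕ → Measure ℝ} {μ : Measure ℝ}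
    [∀ n, IsProbabilityMeasure (μs n)] [IsProbabilityMeasure μ] (h : WeakTendsto μs μ) (ξ : ℝ) :
    Tendsto (fun n => charFun (μs n) ξ) atTop (𝓝 (charFun μ ξ)) := by
  have h' : Tendsto (β := ProbabilityMeasure ℝ) (fun n => ⟨μs n, inferInstance⟩) atTop
      (𝓝 ⟨μ, inferInstance⟩) :=
    ProbabilityMeasure.tendsto_iff_forall_integral_tendsto.2 h
  exact ProbabilityMeasure.tendsto_iff_tendsto_charFun.1 h' ξ

lemma cosTransform_le_one (ν : Measure ℝ) [IsProbabilityMeasure ν] (ξ : ℝ) :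
    cosTransform ν ξ ≤ 1 := by
  calc cosTransform ν ξ ≤ ∫ _, (1 : ℝ) ∂ν :=
        integral_mono (integrable_cos_mul ν ξ) (integrable_const _) fun t => Real.cos_le_one _
    _ = 1 := by simp

lemma one_sub_cosTransform_eq (ν : Measure ℝ) [IsProbabilityMeasure ν] (ξ : ℝ) :
    1 - cosTransform ν ξ = ∫ t, (1 - Real.cos (t * ξ)) ∂ν := by
  rw [integral_sub (integrable_const _) (integrable_cos_mul ν ξ)]
  simp [cosTransform]

lemma one_sub_cosTransform_le (ν : Measure ℝ) [IsProbabilityMeasure ν] (ξ : ℝ) :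
    1 - cosTransform ν ξ ≤ 2 * (1 - cosTransform ν (ξ / 2) ^ 2) := by
  have hcosint := integrable_cos_mul ν (ξ / 2)
  have hsq : cosTransform ν ξ = ∫ t, (2 * Real.cos (t * (ξ / 2)) ^ 2 - 1) ∂ν := by
    rw [cosTransform]
    congr with t
    rw [← Real.cos_two_mul]
    ring_nf
  have hinteg : Integrable (fun t => Real.cos (t * (ξ / 2)) ^ 2) ν :=
    integrable_of_continuous_of_bound ν (by fun_prop) 1 fun x => by
      rw [norm_pow]
      exact pow_le_one₀ (norm_nonneg _) (Real.abs_cos_le_one _)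
  set m := cosTransform ν (ξ / 2) with hm
  have hvar : 0 ≤ ∫ t, (Real.cos (t * (ξ / 2)) - m) ^ 2 ∂ν :=
    integral_nonneg fun t => sq_nonneg _
  have hexp : ∫ t, (Real.cos (t * (ξ / 2)) - m) ^ 2 ∂ν
      = ∫ t, Real.cos (t * (ξ / 2)) ^ 2 ∂ν - m ^ 2 := by
    have : ∀ t, (Real.cos (t * (ξ / 2)) - m) ^ 2
        = Real.cos (t * (ξ / 2)) ^ 2 - (2 * m * Real.cos (t * (ξ / 2)) - m ^ 2) := fun t => by ring
    simp_rw [this]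
    have hlin : Integrable (fun t => 2 * m * Real.cos (t * (ξ / 2)) - m ^ 2) ν :=
      (hcosint.const_mul _).sub (integrable_const _)
    rw [integral_sub hinteg hlin,
      integral_sub (hcosint.const_mul _) (integrable_const _), integral_const_mul]
    change _ - (2 * m * m - _) = _
    simp
    ring
  rw [hsq, integral_sub (hinteg.const_mul _) (integrable_const _), integral_const_mul]
  simp only [integral_const, probReal_univ, smul_eq_mul, mul_one]
  linarith

lemma one_sub_cos_nat_mul_le (j : ℕ) (x : ℝ) :
    1 - Real.cos (j * x) ≤ j ^ 2 * (1 - Real.cos x) := by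
  have hsin : ∀ (j : ℕ) (y : ℝ), |Real.sin (j * y)| ≤ j * |Real.sin y| := by
    intro j y
    induction j with
    | zero => simp
    | succ j ih =>
      push_cast
      rw [add_mul, one_mul, Real.sin_add]
      calc _ ≤ |Real.sin (j * y)| * |Real.cos y| + |Real.cos (j * y)| * |Real.sin y| := by
            rw [← abs_mul, ← abs_mul]
            exact abs_add_le _ _
        _ ≤ (j * |Real.sin y|) * 1 + 1 * |Real.sin y| := by
            gcongr
            · exact Real.abs_cos_le_one _
            · exact Real.abs_cos_le_one _
        _ = _ := by ring
  have hhalf : ∀ z : ℝ, 1 - Real.cos z = 2 * |Real.sin (z / 2)| ^ 2 := fun z => by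
    rw [sq_abs, Real.sin_sq_eq_half_sub]
    ring_nf
  rw [hhalf, hhalf, mul_div_assoc]
  calc 2 * |Real.sin (j * (x / 2))| ^ 2 ≤ 2 * (j * |Real.sin (x / 2)|) ^ 2 := by
        gcongr
        exact hsin j _
    _ = _ := by ring

lemma one_sub_cosTransform_nat_mul_le (ν : Measure ℝ) [IsProbabilityMeasure ν] (j : ℕ) (ξ : ℝ) :
    1 - cosTransform ν (j * ξ) ≤ j ^ 2 * (1 - cosTransform ν ξ) := by
  rw [one_sub_cosTransform_eq, one_sub_cosTransform_eq, ← integral_const_mul]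
  refine integral_mono ((integrable_const _).sub (integrable_cos_mul ν _))
    (((integrable_const _).sub (integrable_cos_mul ν _)).const_mul _) fun t => ?_
  have h := one_sub_cos_nat_mul_le j (t * ξ)
  rwa [← mul_assoc, mul_comm (j : ℝ) t, mul_assoc] at h

lemma cosTransform_convPow (ν : Measure ℝ) [IsProbabilityMeasure ν]
    (hsym : ν.map (fun x => -x) = ν) (k : ℕ) (ξ : ℝ) :
    cosTransform (convPow ν k) ξ = cosTransform ν ξ ^ k := by
  rw [← charFun_re, charFun_convPow, charFun_eq_cosTransform ν hsym, ← ofReal_pow, ofReal_re]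

/-- Truncated quadratic function, dominating `t ↦ 1 - cos (t * ξ)` for `|ξ| ≤ δ`. -/
noncomputable def truncSq (δ : ℝ) : ℝ →ᵇ ℝ :=
  BoundedContinuousFunction.ofNormedAddCommGroup (fun t => min 2 ((t * δ) ^ 2 / 2))
    (by fun_prop) 2 fun t => by
      rw [Real.norm_of_nonneg (le_min (by norm_num) (by positivity))]
      exact min_le_left _ _

lemma one_sub_cos_le_truncSq {δ ξ : ℝ} (h : |ξ| ≤ δ) (t : ℝ) :
    1 - Real.cos (t * ξ) ≤ truncSq δ t := by
  change _ ≤ min 2 ((t * δ) ^ 2 / 2)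
  refine le_min (by linarith [Real.neg_one_le_cos (t * ξ)]) ?_
  have h1 := Real.one_sub_sq_div_two_le_cos (x := t * ξ)
  have h2 : ξ ^ 2 ≤ δ ^ 2 := by
    rw [← sq_abs ξ]
    gcongr
  have h3 : (t * ξ) ^ 2 ≤ (t * δ) ^ 2 := by
    rw [mul_pow, mul_pow]
    gcongr
  linarith

lemma exists_integral_truncSq_lt (μ : Measure ℝ) [IsFiniteMeasure μ] {ε : ℝ} (hε : 0 < ε) :
    ∃ δ > 0, ∫ t, truncSq δ t ∂μ < ε := by
  have hlim : Tendsto (fun j : ℕ => ∫ t, truncSq (1 / ((j : ℝ) + 1)) t ∂μ) atTop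
      (𝓝 (∫ _, (0 : ℝ) ∂μ)) := by
    refine tendsto_integral_of_dominated_convergence (fun _ => 2)
      (fun j => (truncSq _).continuous.aestronglyMeasurable) (integrable_const _)
      (fun j => ae_of_all _ fun t => ?_) (ae_of_all _ fun t => ?_)
    · change ‖min 2 ((t * (1 / ((j : ℝ) + 1))) ^ 2 / 2)‖ ≤ 2
      rw [Real.norm_of_nonneg (le_min (by norm_num) (by positivity))]
      exact min_le_left _ _
    · change Tendsto (fun j : ℕ => min 2 ((t * (1 / ((j : ℝ) + 1))) ^ 2 / 2)) atTop (𝓝 0)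
      have hcont : Continuous fun x : ℝ => min 2 ((t * x) ^ 2 / 2) := by fun_prop
      have h := (hcont.tendsto 0).comp (tendsto_one_div_add_atTop_nhds_zero_nat (𝕜 := ℝ))
      simpa [Function.comp_def] using h
  rw [integral_zero] at hlim
  obtain ⟨j, hj⟩ := (hlim.eventually_lt_const hε).exists
  exact ⟨_, by positivity, hj⟩

/-- Along a weakly convergent sequence of convolution powers of symmetric measures, the rescaled
functions `k (1 - φ)` grow at most quadratically, uniformly. -/
lemma WeakTendsto.exists_bound_one_sub_cosTransform {ν : ℕ → Measure ℝ}
    [∀ n, IsProbabilityMeasure (ν n)] (hsym : ∀ n, (ν n).map (fun x => -x) = ν n) {k : ℕ → ℕ}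
    {μ : Measure ℝ} [IsProbabilityMeasure μ]
    (hconv : WeakTendsto (fun n => convPow (ν n) (k n)) μ) :
    ∃ C : ℝ, ∀ᶠ n in atTop, ∀ h, k n * (1 - cosTransform (ν n) h) ≤ C * (1 + h ^ 2) := by
  obtain ⟨δ, hδ, hlt⟩ := exists_integral_truncSq_lt μ (ε := 1 / 2) (by norm_num)
  set B : ℝ := 2 * -Real.log (1 / 4) with hB
  have hB0 : 0 ≤ B := by
    have := Real.log_nonpos (x := 1 / 4) (by norm_num) (by norm_num)
    linarith
  refine ⟨B * (2 / δ ^ 2 + 8), ?_⟩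
  filter_upwards [(hconv (truncSq δ)).eventually_lt_const hlt] with n hn h
  have hhalf : ∀ ξ, |ξ| ≤ δ → 1 / 2 ≤ cosTransform (ν n) ξ ^ k n := by
    intro ξ hξ
    rw [← cosTransform_convPow (ν n) (hsym n)]
    have h1 : 1 - cosTransform (convPow (ν n) (k n)) ξ ≤
        ∫ t, truncSq δ t ∂(convPow (ν n) (k n)) := by
      rw [one_sub_cosTransform_eq]
      exact integral_mono ((integrable_const _).sub (integrable_cos_mul _ _))
        (BoundedContinuousFunction.integrable _ _) (one_sub_cos_le_truncSq hξ)
    linarith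
  have hsmall : ∀ ξ, |ξ| ≤ δ → k n * (1 - cosTransform (ν n) ξ) ≤ B := by
    intro ξ hξ
    have hq : 1 / 4 ≤ (cosTransform (ν n) (ξ / 2) ^ 2) ^ k n := by
      have h2 := hhalf (ξ / 2) (by rw [abs_div, abs_two]; linarith [abs_nonneg ξ])
      rw [← pow_mul, mul_comm, pow_mul]
      nlinarith
    have h3 := mul_one_sub_le_neg_log (sq_nonneg _) (by norm_num) (by norm_num) hq
    calc k n * (1 - cosTransform (ν n) ξ)
        ≤ k n * (2 * (1 - cosTransform (ν n) (ξ / 2) ^ 2)) := by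
          gcongr
          exact one_sub_cosTransform_le _ _
      _ = 2 * (k n * (1 - cosTransform (ν n) (ξ / 2) ^ 2)) := by ring
      _ ≤ B := by rw [hB]; gcongr
  set j : ℕ := ⌈|h| / δ⌉₊ + 1 with hj
  have hj0 : (0 : ℝ) < j := by positivity
  have hj1 : |h| / δ ≤ j := by
    rw [hj]
    push_cast
    linarith [Nat.le_ceil (|h| / δ)]
  have hj2 : (j : ℝ) ≤ |h| / δ + 2 := by
    rw [hj]
    push_cast
    linarith [Nat.ceil_lt_add_one (show 0 ≤ |h| / δ by positivity)]
  have hhj : |h / j| ≤ δ := by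
    rw [abs_div, abs_of_pos hj0, div_le_iff₀ hj0]
    rw [div_le_iff₀ hδ] at hj1
    linarith
  have hmul : (j : ℝ) * (h / j) = h := mul_div_cancel₀ _ hj0.ne'
  have hj3 : (j : ℝ) ^ 2 ≤ (2 / δ ^ 2 + 8) * (1 + h ^ 2) := by
    calc (j : ℝ) ^ 2 ≤ (|h| / δ + 2) ^ 2 := by gcongr
      _ ≤ 2 * (|h| / δ) ^ 2 + 8 := by nlinarith [sq_nonneg (|h| / δ - 2)]
      _ = 2 / δ ^ 2 * h ^ 2 + 8 := by rw [div_pow, sq_abs]; ring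
      _ ≤ _ := by
        have : 0 ≤ 2 / δ ^ 2 := by positivity
        nlinarith [sq_nonneg h]
  calc k n * (1 - cosTransform (ν n) h)
      = k n * (1 - cosTransform (ν n) (j * (h / j))) := by rw [hmul]
    _ ≤ k n * (j ^ 2 * (1 - cosTransform (ν n) (h / j))) := by
        gcongr
        exact one_sub_cosTransform_nat_mul_le _ _ _
    _ = j ^ 2 * (k n * (1 - cosTransform (ν n) (h / j))) := by ring
    _ ≤ (2 / δ ^ 2 + 8) * (1 + h ^ 2) * B := by
        gcongr
        · exact mul_nonneg (Nat.cast_nonneg _) (by linarith [cosTransform_le_one (ν n) (h / j)])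
        · exact hsmall _ hhj
    _ = _ := by ring

lemma WeakTendsto.tendsto_mul_cosTransform_sub_one {ν : ℕ → Measure ℝ}
    [∀ n, IsProbabilityMeasure (ν n)] (hsym : ∀ n, (ν n).map (fun x => -x) = ν n) {k : ℕ → ℕ}
    (hk : Tendsto k atTop atTop) {μ : Measure ℝ} [IsProbabilityMeasure μ]
    (hconv : WeakTendsto (fun n => convPow (ν n) (k n)) μ) {ξ L : ℝ}
    (hL : charfun μ ξ = exp (L : ℂ)) :
    Tendsto (fun n => k n * (cosTransform (ν n) ξ - 1)) atTop (𝓝 L) := by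
  refine tendsto_mul_sub_one_of_tendsto_pow ?_ ?_
  · obtain ⟨C, hC⟩ := hconv.exists_bound_one_sub_cosTransform hsym
    have hlow : Tendsto (fun n => 1 - C * (1 + ξ ^ 2) * ((k n : ℝ))⁻¹) atTop (𝓝 1) := by
      have h := ((tendsto_inv_atTop_nhds_zero_nat (𝕜 := ℝ)).comp hk).const_mul (C * (1 + ξ ^ 2))
      have h' := h.const_sub 1
      rw [mul_zero, sub_zero] at h'
      exact h'
    refine tendsto_of_tendsto_of_tendsto_of_le_of_le' hlow tendsto_const_nhds ?_
      (.of_forall fun n => cosTransform_le_one _ _)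
    filter_upwards [hC, hk.eventually_gt_atTop 0] with n hn hkn
    have hkn' : (0 : ℝ) < k n := Nat.cast_pos.2 hkn
    have h := hn ξ
    rw [← le_div_iff₀' hkn', div_eq_mul_inv] at h
    linarith
  · have h := (continuous_re.tendsto _).comp (hconv.tendsto_charFun ξ)
    rw [← charfun_eq_charFun, hL, ← ofReal_exp, ofReal_re] at h
    refine h.congr fun n => ?_
    rw [Function.comp_apply, charFun_re, cosTransform_convPow _ (hsym n)]

lemma levy1_eq (ξ t : ℝ) :
    levy1 ξ t = -((1 + t ^ 2) * (ξ ^ 2 / 2) * Real.sinc (t * ξ / 2) ^ 2) := by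
  rw [levy1]
  split_ifs with ht
  · simp [ht, neg_div]
  rcases eq_or_ne ξ 0 with rfl | hξ
  · simp
  have h : Real.cos (t * ξ) = 1 - 2 * Real.sin (t * ξ / 2) ^ 2 := by
    rw [Real.sin_sq_eq_half_sub]
    ring_nf
  rw [h, Real.sinc_of_ne_zero (by positivity)]
  field_simp
  ring

lemma continuous_levy1 : Continuous fun p : ℝ × ℝ => levy1 p.1 p.2 := by
  simp_rw [levy1_eq]
  have := Real.continuous_sinc
  fun_prop

lemma levy1_nonpos (ξ t : ℝ) : levy1 ξ t ≤ 0 := by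
  rw [levy1_eq]
  exact neg_nonpos.2 (by positivity)

lemma abs_levy1_le (ξ t : ℝ) : |levy1 ξ t| ≤ ξ ^ 2 / 2 + 2 := by
  rw [abs_of_nonpos (levy1_nonpos ξ t), levy1]
  split_ifs with ht
  · linarith
  have h1 := Real.one_sub_sq_div_two_le_cos (x := t * ξ)
  have h2 := Real.neg_one_le_cos (t * ξ)
  have ht2 : 0 < t ^ 2 := by positivity
  rw [← neg_div, div_le_iff₀ ht2]
  nlinarith

lemma integrable_levy1 (G : Measure ℝ) [IsFiniteMeasure G] (ξ : ℝ) :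
    Integrable (levy1 ξ) G :=
  integrable_of_continuous_of_bound G
    (continuous_levy1.comp (by fun_prop : Continuous fun t : ℝ => (ξ, t))) _ (abs_levy1_le ξ)

lemma cos_mul_levy1 (ξ h t : ℝ) :
    Real.cos (t * ξ) * levy1 h t
      = (levy1 (ξ + h) t + levy1 (ξ - h) t) / 2 - levy1 ξ t := by
  simp only [levy1]
  split_ifs with ht
  · simp only [ht, zero_mul, Real.cos_zero]
    ring
  · rw [mul_add t, mul_sub t, Real.cos_add, Real.cos_sub]
    ring

lemma integrableOn_exp_neg_mul_sq :
    IntegrableOn (fun h : ℝ => Real.exp (-h) * h ^ 2) (Set.Ioi 0) := by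
  have h := Real.GammaIntegral_convergent (s := 3) (by norm_num)
  refine h.congr_fun (fun x _ => ?_) measurableSet_Ioi
  norm_num

lemma integral_exp_neg_mul_sq : ∫ h in Set.Ioi (0 : ℝ), Real.exp (-h) * h ^ 2 = 2 := by
  have h := Real.Gamma_eq_integral (s := 3) (by norm_num)
  have h3 : Real.Gamma 3 = 2 := by norm_num [Nat.factorial]
  rw [← h3, h]
  congr with x
  norm_num

lemma integral_exp_neg_mul_cos (t : ℝ) :
    ∫ h in Set.Ioi (0 : ℝ), Real.exp (-h) * Real.cos (t * h) = 1 / (1 + t ^ 2) := by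
  have hre : (-1 + t * I : ℂ).re < 0 := by simp
  have h := integral_exp_mul_complex_Ioi hre 0
  have hinteg := integrableOn_exp_mul_complex_Ioi hre 0
  have h2 := integral_re hinteg
  simp only [RCLike.re_to_complex] at h2
  rw [h] at h2
  have h3 : ∀ x : ℝ, (cexp ((-1 + t * I) * x)).re = Real.exp (-x) * Real.cos (t * x) := by
    intro x
    rw [Complex.exp_re]
    simp
  simp_rw [h3] at h2
  rw [h2]
  simp [Complex.div_re, Complex.normSq_apply]
  ring

lemma integrableOn_exp_neg : IntegrableOn (fun h : ℝ => Real.exp (-h)) (Set.Ioi 0) := by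
  simpa using integrableOn_exp_mul_Ioi (a := -1) (by norm_num) 0

lemma integrableOn_exp_neg_mul_cos (t : ℝ) :
    IntegrableOn (fun h : ℝ => Real.exp (-h) * Real.cos (t * h)) (Set.Ioi 0) := by
  refine integrableOn_exp_neg.mono' (by fun_prop) (ae_of_all _ fun h => ?_)
  rw [norm_mul, Real.norm_of_nonneg (Real.exp_pos _).le]
  exact mul_le_of_le_one_right (Real.exp_pos _).le (Real.abs_cos_le_one _)

lemma integral_exp_neg_mul_levy1 (t : ℝ) :
    ∫ h in Set.Ioi (0 : ℝ), Real.exp (-h) * levy1 h t = -1 := by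
  rcases eq_or_ne t 0 with rfl | ht
  · have h : ∀ h : ℝ, Real.exp (-h) * levy1 h 0 = -(1 / 2) * (Real.exp (-h) * h ^ 2) := by
      intro h
      rw [levy1, if_pos rfl]
      ring
    simp_rw [h]
    rw [integral_const_mul, integral_exp_neg_mul_sq]
    norm_num
  · have h : ∀ h : ℝ, Real.exp (-h) * levy1 h t
        = (1 + t ^ 2) / t ^ 2 * (Real.exp (-h) * Real.cos (t * h) - Real.exp (-h)) := by
      intro h
      rw [levy1, if_neg ht]
      ring
    simp_rw [h]
    rw [integral_const_mul, integral_sub (integrableOn_exp_neg_mul_cos t) integrableOn_exp_neg,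
      integral_exp_neg_mul_cos, integral_exp_neg_Ioi_zero]
    field_simp
    ring

lemma integral_cos_mul_levy1 (G : Measure ℝ) [IsFiniteMeasure G] (ξ h : ℝ) :
    ∫ t, Real.cos (t * ξ) * levy1 h t ∂G
      = ((∫ t, levy1 (ξ + h) t ∂G) + ∫ t, levy1 (ξ - h) t ∂G) / 2 - ∫ t, levy1 ξ t ∂G := by
  simp_rw [cos_mul_levy1]
  rw [integral_sub _ (integrable_levy1 G ξ), integral_div,
    integral_add (integrable_levy1 G _) (integrable_levy1 G _)]
  exact ((integrable_levy1 G _).add (integrable_levy1 G _)).div_const 2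

lemma integrableOn_exp_neg_mul_quadratic (a b : ℝ) :
    IntegrableOn (fun h : ℝ => Real.exp (-h) * (a * h ^ 2 + b)) (Set.Ioi 0) := by
  refine ((integrableOn_exp_neg_mul_sq.const_mul a).add (integrableOn_exp_neg.const_mul b)).congr
    (ae_of_all _ fun x => ?_)
  simp only [Pi.add_apply]
  ring

/-- The cosine transform of `G` recovered from its symmetric Lévy–Khinchine exponent. -/
lemma cosTransform_eq_integral_levy1 (G : Measure ℝ) [IsFiniteMeasure G] (ξ : ℝ) :
    cosTransform G ξ =
      -∫ h in Set.Ioi (0 : ℝ), Real.exp (-h) * ∫ t, Real.cos (t * ξ) * levy1 h t ∂G := by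
  have hcont : Continuous fun p : ℝ × ℝ =>
      Real.exp (-p.1) * (Real.cos (p.2 * ξ) * levy1 p.1 p.2) := by
    have := continuous_levy1
    fun_prop
  have hinteg : Integrable
      (Function.uncurry fun h t : ℝ => Real.exp (-h) * (Real.cos (t * ξ) * levy1 h t))
      ((volume.restrict (Set.Ioi (0 : ℝ))).prod G) := by
    have hdom : Integrable
        (fun p : ℝ × ℝ => (Real.exp (-p.1) * (1 / 2 * p.1 ^ 2 + 2)) * (1 : ℝ))
        ((volume.restrict (Set.Ioi (0 : ℝ))).prod G) :=
      Integrable.mul_prod (f := fun h : ℝ => Real.exp (-h) * (1 / 2 * h ^ 2 + 2))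
        (g := fun _ => (1 : ℝ)) (integrableOn_exp_neg_mul_quadratic _ _) (integrable_const _)
    refine hdom.mono' hcont.aestronglyMeasurable (ae_of_all _ fun p => ?_)
    simp only [Function.uncurry, norm_mul, mul_one, Real.norm_eq_abs, Real.abs_exp]
    gcongr
    calc |Real.cos (p.2 * ξ)| * |levy1 p.1 p.2| ≤ 1 * (p.1 ^ 2 / 2 + 2) := by
          gcongr
          · exact Real.abs_cos_le_one _
          · exact abs_levy1_le _ _
      _ = _ := by ring
  simp_rw [← integral_const_mul]
  rw [integral_integral_swap hinteg, cosTransform, ← integral_neg]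
  congr with t
  have h : ∀ h : ℝ, Real.exp (-h) * (Real.cos (t * ξ) * levy1 h t)
      = Real.cos (t * ξ) * (Real.exp (-h) * levy1 h t) := fun h => by ring
  simp_rw [h]
  rw [integral_const_mul, integral_exp_neg_mul_levy1]
  ring

lemma abs_integral_cos_mul_levy1_le (G : Measure ℝ) [IsFiniteMeasure G] (ξ h : ℝ) :
    |∫ t, Real.cos (t * ξ) * levy1 h t ∂G| ≤ -∫ t, levy1 h t ∂G := by
  rw [← integral_neg]
  refine norm_integral_le_of_norm_le (f := fun t => Real.cos (t * ξ) * levy1 h t)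
    (integrable_levy1 G h).neg (ae_of_all _ fun t => ?_)
  rw [norm_mul, Real.norm_eq_abs, Real.norm_eq_abs, abs_of_nonpos (levy1_nonpos h t)]
  exact mul_le_of_le_one_left (neg_nonneg.2 (levy1_nonpos h t)) (Real.abs_cos_le_one _)

/-- Pointwise convergence of the Lévy–Khinchine exponents, with a uniform quadratic bound, implies
convergence of the cosine transforms of the Lévy measures. -/
lemma tendsto_cosTransform_of_tendsto_levy1 {Gs : ℕ → Measure ℝ} [∀ n, IsFiniteMeasure (Gs n)]
    {G : Measure ℝ} [IsFiniteMeasure G] {C : ℝ}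
    (hbound : ∀ᶠ n in atTop, ∀ h, -∫ t, levy1 h t ∂(Gs n) ≤ C * (1 + h ^ 2))
    (hlim : ∀ ξ, Tendsto (fun n => ∫ t, levy1 ξ t ∂(Gs n)) atTop (𝓝 (∫ t, levy1 ξ t ∂G))) (ξ : ℝ) :
    Tendsto (fun n => cosTransform (Gs n) ξ) atTop (𝓝 (cosTransform G ξ)) := by
  simp_rw [cosTransform_eq_integral_levy1]
  refine Tendsto.neg (tendsto_integral_filter_of_dominated_convergence
    (fun h => Real.exp (-h) * (C * h ^ 2 + C)) (.of_forall fun n => ?_) ?_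
    (integrableOn_exp_neg_mul_quadratic C C) (ae_of_all _ fun h => ?_))
  · have hmeas : StronglyMeasurable fun h => ∫ t, Real.cos (t * ξ) * levy1 h t ∂(Gs n) := by
      have hc : Continuous fun p : ℝ × ℝ => Real.cos (p.2 * ξ) * levy1 p.1 p.2 := by
        have := continuous_levy1
        fun_prop
      exact hc.stronglyMeasurable.integral_prod_right (ν := Gs n)
    exact ((by fun_prop : Continuous fun h : ℝ => Real.exp (-h)).stronglyMeasurable.mul
      hmeas).aestronglyMeasurable
  · filter_upwards [hbound] with n hn
    refine ae_of_all _ fun h => ?_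
    rw [norm_mul, Real.norm_of_nonneg (Real.exp_pos _).le]
    gcongr
    calc _ ≤ _ := abs_integral_cos_mul_levy1_le (Gs n) ξ h
      _ ≤ _ := hn h
      _ = _ := by ring
  · refine Tendsto.const_mul _ ?_
    simp_rw [integral_cos_mul_levy1]
    exact (((hlim _).add (hlim _)).div_const 2).sub (hlim ξ)

/-- The Lévy continuity theorem for finite measures. -/
lemma FiniteMeasure.tendsto_of_tendsto_charFun {Gs : ℕ → FiniteMeasure ℝ} {G : FiniteMeasure ℝ}
    (h : ∀ ξ, Tendsto (fun n => charFun (Gs n : Measure ℝ) ξ) atTop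
      (𝓝 (charFun (G : Measure ℝ) ξ))) :
    Tendsto Gs atTop (𝓝 G) := by
  have hmass : Tendsto (fun n => (Gs n).mass) atTop (𝓝 G.mass) := by
    have h0 := (continuous_re.tendsto _).comp (h 0)
    simp only [Function.comp_def, charFun_zero, ofReal_re] at h0
    exact NNReal.tendsto_coe.1 h0
  rcases eq_or_ne G 0 with rfl | hG
  · exact FiniteMeasure.tendsto_zero_of_tendsto_zero_mass (by simpa using hmass)
  have hG' : G.mass ≠ 0 := G.mass_nonzero_iff.2 hG
  refine FiniteMeasure.tendsto_of_tendsto_normalize_testAgainstNN_of_tendsto_mass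
    (ProbabilityMeasure.tendsto_of_tendsto_charFun fun ξ => ?_) hmass
  have hnorm : ∀ F : FiniteMeasure ℝ, F.mass ≠ 0 →
      charFun (F.normalize : Measure ℝ) ξ = ((F.mass : ℝ) : ℂ)⁻¹ * charFun (F : Measure ℝ) ξ := by
    intro F hF
    rw [F.toMeasure_normalize_eq_of_nonzero (F.mass_nonzero_iff.1 hF), charFun_apply, charFun_apply,
      integral_smul_nnreal_measure]
    rw [NNReal.smul_def, Complex.real_smul, NNReal.coe_inv, ofReal_inv]
  rw [hnorm G hG']
  have hm : Tendsto (fun n => (((Gs n).mass : ℝ) : ℂ)⁻¹) atTop (𝓝 ((G.mass : ℝ) : ℂ)⁻¹) :=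
    ((continuous_ofReal.tendsto _).comp (NNReal.tendsto_coe.2 hmass)).inv₀
      (by simpa using hG')
  refine (hm.mul (h ξ)).congr' ?_
  filter_upwards [hmass.eventually_ne hG'] with n hn
  rw [hnorm _ hn]

/-- If characteristic functions of probability measures converge pointwise to a function continuous
at `0`, then the measures converge weakly to a probability measure with that characteristic
function. -/
lemma exists_tendsto_of_tendsto_charFun {μs : ℕ → ProbabilityMeasure ℝ} {f : ℝ → ℂ}
    (hf : ContinuousAt f 0)
    (h : ∀ ξ, Tendsto (fun n => charFun (μs n : Measure ℝ) ξ) atTop (𝓝 (f ξ))) :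
    ∃ ρ : ProbabilityMeasure ℝ, (∀ ξ, charFun (ρ : Measure ℝ) ξ = f ξ) ∧
      Tendsto μs atTop (𝓝 ρ) := by
  have htight : IsTightMeasureSet (Set.range fun n => (μs n : Measure ℝ)) :=
    isTightMeasureSet_of_tendsto_charFun hf h
  have hcompact : IsCompact (closure (Set.range μs)) :=
    isCompact_closure_of_isTightMeasureSet (by simpa [Set.range] using htight)
  obtain ⟨ρ, -, φ, hφ, hρ⟩ := hcompact.isSeqCompact fun n => subset_closure (Set.mem_range_self n)
  have hchar : ∀ ξ, charFun (ρ : Measure ℝ) ξ = f ξ := fun ξ =>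
    tendsto_nhds_unique (ProbabilityMeasure.tendsto_iff_tendsto_charFun.1 hρ ξ)
      ((h ξ).comp hφ.tendsto_atTop)
  refine ⟨ρ, hchar, ProbabilityMeasure.tendsto_of_tendsto_charFun fun ξ => ?_⟩
  rw [hchar]
  exact h ξ

/-- The measure with density `k t² / (1 + t²)` with respect to `ν`. -/
noncomputable def levyWeight (k : ℕ) (ν : Measure ℝ) : Measure ℝ :=
  ν.withDensity fun t => ENNReal.ofReal (k * (t ^ 2 / (1 + t ^ 2)))

lemma continuous_sq_div_one_add_sq : Continuous fun t : ℝ => t ^ 2 / (1 + t ^ 2) :=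
  (by fun_prop : Continuous fun t : ℝ => t ^ 2).div (by fun_prop) fun t => by positivity

lemma sq_div_one_add_sq_le_one (t : ℝ) : t ^ 2 / (1 + t ^ 2) ≤ 1 :=
  (div_le_one (by positivity)).2 (by linarith)

instance isFiniteMeasure_levyWeight (k : ℕ) (ν : Measure ℝ) [IsFiniteMeasure ν] :
    IsFiniteMeasure (levyWeight k ν) := by
  refine isFiniteMeasure_withDensity_ofReal (Integrable.const_mul ?_ _).2
  refine integrable_of_continuous_of_bound ν continuous_sq_div_one_add_sq 1 fun t => ?_
  rw [Real.norm_of_nonneg (by positivity)]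
  exact sq_div_one_add_sq_le_one t

lemma integral_levyWeight {E : Type*} [NormedAddCommGroup E] [NormedSpace ℝ E] (k : ℕ)
    (ν : Measure ℝ) (f : ℝ → E) :
    ∫ t, f t ∂(levyWeight k ν) = (k : ℝ) • ∫ t, (t ^ 2 / (1 + t ^ 2)) • f t ∂ν := by
  rw [levyWeight, integral_withDensity_eq_integral_toReal_smul
    (continuous_sq_div_one_add_sq.measurable.const_mul _).ennreal_ofReal
    (ae_of_all _ fun _ => ENNReal.ofReal_lt_top), ← integral_smul]
  congr with t
  rw [ENNReal.toReal_ofReal (by positivity), mul_smul]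

lemma map_neg_levyWeight (k : ℕ) (ν : Measure ℝ) (hsym : ν.map (fun x => -x) = ν) :
    (levyWeight k ν).map (fun x => -x) = levyWeight k ν := by
  have hmeas : Measurable fun t : ℝ => ENNReal.ofReal (k * (t ^ 2 / (1 + t ^ 2))) :=
    (continuous_sq_div_one_add_sq.measurable.const_mul _).ennreal_ofReal
  ext s hs
  rw [Measure.map_apply (by fun_prop) hs, levyWeight,
    withDensity_apply _ (measurable_neg hs), withDensity_apply _ hs]
  conv_rhs => rw [← hsym, setLIntegral_map hs hmeas (by fun_prop)]
  simp

lemma integral_levy1_levyWeight (k : ℕ) (ν : Measure ℝ) [IsProbabilityMeasure ν] (ξ : ℝ) :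
    ∫ t, levy1 ξ t ∂(levyWeight k ν) = k * (cosTransform ν ξ - 1) := by
  rw [integral_levyWeight, ← neg_sub, one_sub_cosTransform_eq, smul_eq_mul, ← integral_neg]
  congr with t
  rw [smul_eq_mul, levy1]
  split_ifs with ht
  · simp [ht]
  · field_simp
    ring

/-- The function `t ↦ (e^{iξt²} - 1)(1 + t²)/t²`, extended by continuity at `t = 0`. -/
noncomputable def sqKernel (ξ t : ℝ) : ℂ :=
  I * ξ * (1 + t ^ 2) * exp ((ξ * t ^ 2 / 2 : ℝ) * I) * Real.sinc (ξ * t ^ 2 / 2)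

lemma continuous_sqKernel (ξ : ℝ) : Continuous (sqKernel ξ) := by
  unfold sqKernel
  have := Real.continuous_sinc
  fun_prop

lemma continuous_sqKernel_left (t : ℝ) : Continuous fun ξ => sqKernel ξ t := by
  unfold sqKernel
  have := Real.continuous_sinc
  fun_prop

lemma mul_sinc (x : ℝ) : x * Real.sinc x = Real.sin x := by
  rcases eq_or_ne x 0 with rfl | hx
  · simp
  · rw [Real.sinc_of_ne_zero hx, mul_div_cancel₀ _ hx]

lemma exp_sub_one_eq_sinc (u : ℝ) :
    exp (u * I) - 1 = I * u * exp ((u / 2 : ℝ) * I) * Real.sinc (u / 2) := by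
  have h1 : (u : ℂ) * Real.sinc (u / 2) = 2 * sin ((u / 2 : ℝ) : ℂ) := by
    rw [← ofReal_sin, ← mul_sinc]
    push_cast
    ring
  have h2 : exp (u * I) = exp ((u / 2 : ℝ) * I) ^ 2 := by
    rw [← exp_nat_mul]
    congr 1
    push_cast
    ring
  calc exp (u * I) - 1 = 2 * I * sin ((u / 2 : ℝ) : ℂ) * exp ((u / 2 : ℝ) * I) := by
        rw [h2, exp_mul_I]
        linear_combination (1 : ℂ) * sin_sq_add_cos_sq ((u / 2 : ℝ) : ℂ)
          + (-sin ((u / 2 : ℝ) : ℂ) ^ 2) * I_sq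
    _ = _ := by linear_combination (-I * exp ((u / 2 : ℝ) * I)) * h1

lemma sq_mul_sqKernel (ξ t : ℝ) :
    (t : ℂ) ^ 2 * sqKernel ξ t = (exp ((ξ * t ^ 2 : ℝ) * I) - 1) * (1 + t ^ 2) := by
  rw [exp_sub_one_eq_sinc, sqKernel]
  push_cast
  ring

lemma norm_sqKernel_le (ξ t : ℝ) : ‖sqKernel ξ t‖ ≤ |ξ| + 2 := by
  have h1 : ‖(1 + (t : ℂ) ^ 2)‖ = 1 + t ^ 2 := by
    rw [← ofReal_pow, ← ofReal_one, ← ofReal_add, norm_real, Real.norm_of_nonneg (by positivity)]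
  rw [sqKernel, norm_mul, norm_mul, norm_mul, norm_mul, norm_exp_ofReal_mul_I, norm_I, h1,
    norm_real, norm_real, Real.norm_eq_abs, Real.norm_eq_abs]
  have h2 : |ξ| * t ^ 2 * |Real.sinc (ξ * t ^ 2 / 2)| ≤ 2 := by
    calc _ = 2 * |ξ * t ^ 2 / 2 * Real.sinc (ξ * t ^ 2 / 2)| := by
          rw [abs_mul, abs_div, abs_mul, abs_two, abs_of_nonneg (sq_nonneg t)]
          ring
      _ ≤ 2 * 1 := by
          rw [mul_sinc]
          gcongr
          exact Real.abs_sin_le_one _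
      _ = 2 := by norm_num
  have h3 : |ξ| * |Real.sinc (ξ * t ^ 2 / 2)| ≤ |ξ| :=
    mul_le_of_le_one_right (abs_nonneg _) (Real.abs_sinc_le_one _)
  nlinarith

lemma integrable_sqKernel (G : Measure ℝ) [IsFiniteMeasure G] (ξ : ℝ) :
    Integrable (sqKernel ξ) G :=
  integrable_of_continuous_of_bound G (continuous_sqKernel ξ) (|ξ| + 2) (norm_sqKernel_le ξ)

lemma integral_sqKernel_levyWeight (k : ℕ) (ν : Measure ℝ) [IsProbabilityMeasure ν] (ξ : ℝ) :
    ∫ t, sqKernel ξ t ∂(levyWeight k ν) = k * (charFun (ν.map fun t => t ^ 2) ξ - 1) := by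
  have hinteg : Integrable (fun t : ℝ => exp ((ξ * t ^ 2 : ℝ) * I)) ν :=
    integrable_of_continuous_of_bound ν (by fun_prop) 1 fun t => by rw [norm_exp_ofReal_mul_I]
  have hchar : charFun (ν.map fun t => t ^ 2) ξ = ∫ t : ℝ, exp ((ξ * t ^ 2 : ℝ) * I) ∂ν := by
    rw [charFun_apply_real, integral_map (by fun_prop) (by fun_prop)]
    simp
  have hsub : charFun (ν.map fun t => t ^ 2) ξ - 1 =
      ∫ t : ℝ, (exp ((ξ * t ^ 2 : ℝ) * I) - 1) ∂ν := by
    rw [integral_sub hinteg (integrable_const _), hchar]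
    simp
  rw [integral_levyWeight, hsub, Complex.real_smul, ofReal_natCast]
  congr 2 with t
  have h1 : (1 + (t : ℂ) ^ 2) ≠ 0 := by
    rw [← ofReal_pow, ← ofReal_one, ← ofReal_add, ofReal_ne_zero]
    positivity
  rw [Complex.real_smul]
  push_cast
  rw [div_mul_eq_mul_div, sq_mul_sqKernel, mul_div_cancel_right₀ _ h1]
  push_cast
  ring

lemma continuousAt_integral_sqKernel (G : Measure ℝ) [IsFiniteMeasure G] :
    ContinuousAt (fun ξ => ∫ t, sqKernel ξ t ∂G) 0 := by
  refine continuousAt_of_dominated (bound := fun _ => 3)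
    (.of_forall fun ξ => (integrable_sqKernel G ξ).aestronglyMeasurable) ?_ (integrable_const _)
    (ae_of_all _ fun t => ?_)
  · filter_upwards [Metric.ball_mem_nhds (0 : ℝ) one_pos] with ξ hξ
    refine ae_of_all _ fun t => (norm_sqKernel_le ξ t).trans ?_
    rw [Metric.mem_ball, dist_zero_right, Real.norm_eq_abs] at hξ
    linarith
  · exact (continuous_sqKernel_left t).continuousAt

lemma measurable_levy2 (ξ : ℝ) : Measurable (levy2 ξ) := by
  unfold levy2
  exact Measurable.ite (measurableSet_singleton 0) measurable_const (by fun_prop)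

lemma smul_levy2_sq (ξ t : ℝ) :
    (((t ^ 2) ^ 2 + t ^ 2) / ((t ^ 2) ^ 2 + 1)) • levy2 ξ (t ^ 2)
      = sqKernel ξ t - I * ξ * ((1 + t ^ 2) / (1 + t ^ 4) : ℝ) := by
  rcases eq_or_ne t 0 with rfl | ht
  · simp [sqKernel]
  have ht' : (t : ℂ) ≠ 0 := ofReal_ne_zero.2 ht
  have h4 : (1 + (t : ℂ) ^ 4) ≠ 0 := by
    have : ((1 + t ^ 4 : ℝ) : ℂ) ≠ 0 := ofReal_ne_zero.2 (by positivity)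
    simpa using this
  have hpow : ((t : ℂ) ^ 2) ^ 2 + 1 = 1 + (t : ℂ) ^ 4 := by ring
  have hker : sqKernel ξ t = (exp ((ξ * t ^ 2 : ℝ) * I) - 1) * (1 + t ^ 2) / (t : ℂ) ^ 2 := by
    rw [← sq_mul_sqKernel, mul_div_cancel_left₀ _ (pow_ne_zero 2 ht')]
  have hexp : I * (ξ : ℂ) * ((t ^ 2 : ℝ) : ℂ) = (ξ * t ^ 2 : ℝ) * I := by
    push_cast
    ring
  rw [hker, levy2, if_neg (pow_ne_zero 2 ht), Complex.real_smul, hexp]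
  generalize exp ((ξ * t ^ 2 : ℝ) * I) = e
  push_cast
  rw [hpow]
  field_simp
  ring

/-- The Lévy–Khinchine exponent of the limit law, as a single integral against `G`. -/
lemma levyKhinchine_exponent_eq (G : Measure ℝ) [IsFiniteMeasure G] (ξ : ℝ) :
    I * ((∫ t, (1 + t ^ 2) / (1 + t ^ 4) ∂G : ℝ) : ℂ) * (ξ : ℂ) +
      ∫ x, levy2 ξ x ∂((G.map (fun t => t ^ 2)).withDensity
        (fun x => ENNReal.ofReal ((x ^ 2 + x) / (x ^ 2 + 1)))) = ∫ t, sqKernel ξ t ∂G := by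
  have hdens : Measurable fun x : ℝ => (x ^ 2 + x) / (x ^ 2 + 1) := by fun_prop
  have hinteg : Integrable (fun t : ℝ => (1 + t ^ 2) / (1 + t ^ 4)) G := by
    refine integrable_of_continuous_of_bound G
      ((by fun_prop : Continuous fun t : ℝ => 1 + t ^ 2).div (by fun_prop) fun t => by positivity)
      2 fun t => ?_
    rw [Real.norm_of_nonneg (by positivity), div_le_iff₀ (by positivity)]
    nlinarith [sq_nonneg (t ^ 2 - 1)]
  have hmeas : AEStronglyMeasurable
      (fun x : ℝ => (ENNReal.ofReal ((x ^ 2 + x) / (x ^ 2 + 1))).toReal • levy2 ξ x)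
      (G.map fun t => t ^ 2) :=
    (hdens.ennreal_ofReal.ennreal_toReal.smul (measurable_levy2 ξ)).aestronglyMeasurable
  rw [integral_withDensity_eq_integral_toReal_smul hdens.ennreal_ofReal
      (ae_of_all _ fun _ => ENNReal.ofReal_lt_top),
    integral_map (by fun_prop) hmeas]
  have hpt : ∀ t : ℝ, (ENNReal.ofReal (((t ^ 2) ^ 2 + t ^ 2) / ((t ^ 2) ^ 2 + 1))).toReal •
      levy2 ξ (t ^ 2) = sqKernel ξ t - I * ξ * ((1 + t ^ 2) / (1 + t ^ 4) : ℝ) := fun t => by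
    rw [ENNReal.toReal_ofReal (by positivity), smul_levy2_sq]
  simp_rw [hpt]
  have hinteg' : Integrable (fun t : ℝ => I * ξ * ((1 + t ^ 2) / (1 + t ^ 4) : ℝ)) G :=
    hinteg.ofReal.const_mul _
  rw [integral_sub (integrable_sqKernel G ξ) hinteg', integral_const_mul,
    integral_complex_ofReal]
  ring

/-- Weak convergence of `k t² / (1 + t²) dν` to the Lévy measure of the limit of `ν^{*k}`. -/
lemma tendsto_integral_levyWeight {ν : ℕ → Measure ℝ} [∀ n, IsProbabilityMeasure (ν n)]
    (hsym : ∀ n, (ν n).map (fun x => -x) = ν n) {k : ℕ → ℕ} (hk : Tendsto k atTop atTop)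
    {μ : Measure ℝ} [IsProbabilityMeasure μ]
    (hconv : WeakTendsto (fun n => convPow (ν n) (k n)) μ)
    {G : Measure ℝ} [IsFiniteMeasure G] (hGsym : G.map (fun x => -x) = G)
    (hlevy : ∀ ξ : ℝ, charfun μ ξ = exp ((∫ t, levy1 ξ t ∂G : ℝ) : ℂ)) (f : ℝ →ᵇ ℂ) :
    Tendsto (fun n => ∫ t, f t ∂(levyWeight (k n) (ν n))) atTop (𝓝 (∫ t, f t ∂G)) := by
  obtain ⟨C, hC⟩ := hconv.exists_bound_one_sub_cosTransform hsym
  have hcos := tendsto_cosTransform_of_tendsto_levy1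
    (Gs := fun n => levyWeight (k n) (ν n)) (G := G) (C := C) (by
      filter_upwards [hC] with n hn h
      rw [integral_levy1_levyWeight, ← mul_neg, neg_sub]
      exact hn h) (fun ξ => by
      simp_rw [integral_levy1_levyWeight]
      exact hconv.tendsto_mul_cosTransform_sub_one hsym hk (hlevy ξ))
  have hweak : Tendsto (β := FiniteMeasure ℝ) (fun n => ⟨levyWeight (k n) (ν n), inferInstance⟩)
      atTop (𝓝 ⟨G, inferInstance⟩) := by
    refine FiniteMeasure.tendsto_of_tendsto_charFun fun ξ => ?_
    simp only [FiniteMeasure.toMeasure_mk]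
    rw [charFun_eq_cosTransform G hGsym]
    refine ((continuous_ofReal.tendsto _).comp (hcos ξ)).congr fun n => ?_
    rw [Function.comp_apply, charFun_eq_cosTransform _ (map_neg_levyWeight _ _ (hsym n))]
  exact (FiniteMeasure.tendsto_iff_forall_integral_rclike_tendsto ℂ).1 hweak f

/-- suppose `ν_n` are symmetric probability measures, `k_n → ∞`,
`ν_n^{*k_n} → μ` weakly, where `μ` is symmetric `*`-infinitely divisible with Lévy measure
`G`. Let `ρ_n` be the pushforward of `ν_n` by `t ↦ t²`. Then `ρ_n^{*k_n}` converges weakly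
to the probability measure `ρ` with characteristic function
`ξ ↦ exp(iγξ + ∫ (e^{iξx} − 1 − iξx/(x²+1))·(x²+1)/x² dσ(x))`, where
`γ = ∫ (1+t²)/(1+t⁴) dG(t)` and `σ` has density `x ↦ (x²+x)/(x²+1)` with respect to the
pushforward `F` of `G` by `t ↦ t²`. -/
theorem stmt17 (ν : ℕ → Measure ℝ) (hprob : ∀ n, IsProbabilityMeasure (ν n))
    (hsym : ∀ n, (ν n).map (fun x => -x) = ν n)
    (k : ℕ → ℕ) (hk : Tendsto k atTop atTop)
    (μ : Measure ℝ) [IsProbabilityMeasure μ]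
    (hμconv : WeakTendsto (fun n => convPow (ν n) (k n)) μ)
    (G : Measure ℝ) [IsFiniteMeasure G] (hGsym : G.map (fun x => -x) = G)
    (hlevy : ∀ ξ : ℝ, charfun μ ξ = Complex.exp ((∫ t, levy1 ξ t ∂G : ℝ) : ℂ)) :
    ∃ ρ : Measure ℝ, IsProbabilityMeasure ρ ∧
      (∀ ξ : ℝ, charfun ρ ξ =
        Complex.exp (Complex.I * ((∫ t, (1 + t^2) / (1 + t^4) ∂G : ℝ) : ℂ) * (ξ : ℂ) +
          ∫ x, levy2 ξ x
            ∂((G.map (fun t => t^2)).withDensity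
                (fun x => ENNReal.ofReal ((x^2 + x) / (x^2 + 1)))))) ∧
      WeakTendsto (fun n => convPow ((ν n).map (fun t => t^2)) (k n)) ρ := by
  have hprob' : ∀ n, IsProbabilityMeasure ((ν n).map fun t => t ^ 2) := fun n =>
    Measure.isProbabilityMeasure_map (by fun_prop)
  have hlim : ∀ ξ : ℝ, Tendsto
      (fun n => charFun (convPow ((ν n).map fun t => t ^ 2) (k n)) ξ) atTop
      (𝓝 (Complex.exp (∫ t, sqKernel ξ t ∂G))) := by
    intro ξ
    let f : ℝ →ᵇ ℂ := BoundedContinuousFunction.ofNormedAddCommGroup (sqKernel ξ)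
      (continuous_sqKernel ξ) (|ξ| + 2) (norm_sqKernel_le ξ)
    have h : Tendsto (fun n => ∫ t, sqKernel ξ t ∂(levyWeight (k n) (ν n))) atTop
        (𝓝 (∫ t, sqKernel ξ t ∂G)) :=
      tendsto_integral_levyWeight hsym hk hμconv hGsym hlevy f
    simp_rw [integral_sqKernel_levyWeight] at h
    refine (tendsto_one_add_pow_of_tendsto_mul hk h).congr fun n => ?_
    rw [charFun_convPow, add_sub_cancel]
  obtain ⟨ρ, hchar, hρ⟩ := exists_tendsto_of_tendsto_charFun
    (μs := fun n => ⟨convPow ((ν n).map fun t => t ^ 2) (k n), inferInstance⟩)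
    (continuousAt_integral_sqKernel G).cexp hlim
  refine ⟨ρ, inferInstance, fun ξ => ?_,
    ProbabilityMeasure.tendsto_iff_forall_integral_tendsto.1 hρ⟩
  rw [charfun_eq_charFun, hchar, levyKhinchine_exponent_eq]
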